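/- Assume J = 0, W = [[e^{h_A}, e^{h_AB}], [e^{h_AB}, e^{h_B}]] positive definite, and α ∈ (0,1) with αN₁, αN₂ ∈ ℕ. Then for every N₁, N₂ ∈ ℕ and N = N₁ + N₂, the modified partition functions satisfy the super-multiplicativity Z*_{N₁}·Z*_{N₂} ≤ Z*_N. -/

import Mathlib

noncomputable section
open Real Matrix MeasureTheory

/-- A monomer-dimer configuration: a set of non-degenerate pairwise disjoint edges. -/
def IsMDConfig (N : ℕ) (Δ : Finset (Sym2 (Fin N))) : Prop :=
  (∀ e ∈ Δ, ¬ e.IsDiag) ∧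
    ∀ e ∈ Δ, ∀ e' ∈ Δ, e ≠ e' → ∀ v : Fin N, v ∈ e → v ∉ e'

open scoped Classical in
/-- All monomer-dimer configurations on `N` sites. -/
def mdConfigs (N : ℕ) : Finset (Finset (Sym2 (Fin N))) :=
  Finset.univ.filter fun Δ => IsMDConfig N Δ

open scoped Classical in
/-- Number of dimers internal to population A (sites with index < N_A). -/
def countA (N NA : ℕ) (Δ : Finset (Sym2 (Fin N))) : ℕ :=
  (Δ.filter fun e => ∀ v : Fin N, v ∈ e → (v : ℕ) < NA).card

open scoped Classical in
/-- Number of dimers internal to population B (sites with index ≥ N_A). -/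
def countB (N NA : ℕ) (Δ : Finset (Sym2 (Fin N))) : ℕ :=
  (Δ.filter fun e => ∀ v : Fin N, v ∈ e → NA ≤ (v : ℕ)).card

open scoped Classical in
/-- Number of mixed dimers. -/
def countAB (N NA : ℕ) (Δ : Finset (Sym2 (Fin N))) : ℕ :=
  (Δ.filter fun e =>
    (∃ v : Fin N, v ∈ e ∧ (v : ℕ) < NA) ∧ ∃ v : Fin N, v ∈ e ∧ NA ≤ (v : ℕ)).card

/-- Partition function at J = 0, with dimer activities w_A = e^{h_A}, w_B = e^{h_B},
w_AB = e^{h_AB}. -/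
def mdZ0 (N NA : ℕ) (hA hB hAB : ℝ) : ℝ :=
  ∑ Δ ∈ mdConfigs N,
    (Real.exp hA / N) ^ countA N NA Δ * (Real.exp hB / N) ^ countB N NA Δ *
      (Real.exp hAB / N) ^ countAB N NA Δ

/-- The covariance matrix W. -/
def covW (hA hB hAB : ℝ) : Matrix (Fin 2) (Fin 2) ℝ :=
  !![Real.exp hA, Real.exp hAB; Real.exp hAB, Real.exp hB]

/-- Density of a centred Gaussian vector on ℝ² with covariance matrix `S`. -/
def gaussDensity (S : Matrix (Fin 2) (Fin 2) ℝ) (x : Fin 2 → ℝ) : ℝ :=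
  (2 * Real.pi)⁻¹ * (Real.sqrt S.det)⁻¹ *
    Real.exp (-(1 / 2) * (S⁻¹.mulVec x ⬝ᵥ x))

/-- The modified partition function Z*: the Gaussian expectation restricted to
`Q = {ξ : 1 + ξ_A > 0, 1 + ξ_B > 0}`, for populations of sizes `MA`, `MB` and
covariance `W / (MA + MB)`. -/
def Zstar (MA MB : ℕ) (hA hB hAB : ℝ) : ℝ :=
  ∫ x : Fin 2 → ℝ in {x | -1 < x 0 ∧ -1 < x 1},
    (1 + x 0) ^ MA * (1 + x 1) ^ MB *
      gaussDensity (((MA + MB : ℕ) : ℝ)⁻¹ • covW hA hB hAB) x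

open ProbabilityTheory in
lemma gd_formula (a b d t : ℝ) (ha : 0 < a) (hD : 0 < a * d - b * b) (ht : 0 < t) (x : Fin 2 → ℝ) :
    gaussDensity (t⁻¹ • !![a, b; b, d]) x =
      (2 * π)⁻¹ * (t * (√(a * d - b * b))⁻¹) *
        rexp (-(t / 2) * ((d * x 0 ^ 2 - 2 * b * x 0 * x 1 + a * x 1 ^ 2) / (a * d - b * b))) := by
  have hdet : (t⁻¹ • !![a, b; b, d] : Matrix (Fin 2) (Fin 2) ℝ).det = t⁻¹ ^ 2 * (a * d - b * b) := by
    simp [Matrix.det_fin_two]; ring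
  have hinv : (t⁻¹ • !![a, b; b, d] : Matrix (Fin 2) (Fin 2) ℝ)⁻¹ =
      (t / (a * d - b * b)) • !![d, -b; -b, a] := by
    apply Matrix.inv_eq_right_inv
    ext i j
    fin_cases i <;> fin_cases j <;>
      simp [Matrix.mul_apply, Fin.sum_univ_two] <;> field_simp <;> ring_nf
    all_goals
      have hne : a * d - b ^ 2 ≠ 0 := by nlinarith
      have hne' : -b ^ 2 + a * d ≠ 0 := by nlinarith
      field_simp
      try ring
  unfold gaussDensity
  rw [hdet, hinv, Real.sqrt_mul (by positivity), Real.sqrt_sq (by positivity)]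
  congr 2
  · simp [mul_comm]
  · simp [Matrix.mulVec, dotProduct, Fin.sum_univ_two]
    field_simp
    ring

lemma amgm_pow (β w1 w2 n1 n2 : ℝ) (k1 k2 : ℕ) (h1 : 0 < n1) (h2 : 0 < n2)
    (hw1 : w1 = n1 / (n1 + n2)) (hw2 : w2 = n2 / (n1 + n2))
    (hk1 : (k1 : ℝ) = β * n1) (hk2 : (k2 : ℝ) = β * n2) (p1 p2 : ℝ) (hp1 : 0 < p1) (hp2 : 0 < p2) :
    p1 ^ k1 * p2 ^ k2 ≤ (w1 * p1 + w2 * p2) ^ (k1 + k2) := by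
  have hs : w1 + w2 = 1 := by rw [hw1, hw2]; field_simp
  have hw1' : 0 ≤ w1 := by rw [hw1]; positivity
  have hw2' : 0 ≤ w2 := by rw [hw2]; positivity
  have h := Real.geom_mean_le_arith_mean2_weighted hw1' hw2' hp1.le hp2.le hs
  have h' := pow_le_pow_left₀ (by positivity) h (k1 + k2)
  refine le_trans (le_of_eq ?_) h'
  rw [mul_pow, ← Real.rpow_natCast (p1 ^ w1), ← Real.rpow_natCast (p2 ^ w2),
    ← Real.rpow_mul hp1.le, ← Real.rpow_mul hp2.le]
  have e1 : w1 * ((k1 + k2 : ℕ) : ℝ) = k1 := by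
    push_cast; rw [hk1, hk2, hw1]; field_simp
  have e2 : w2 * ((k1 + k2 : ℕ) : ℝ) = k2 := by
    push_cast; rw [hk1, hk2, hw2]; field_simp
  rw [e1, e2, Real.rpow_natCast, Real.rpow_natCast]

lemma conv_le (F1 F2 G K : (Fin 2 → ℝ) → ENNReal) (hF1 : Measurable F1) (hF2 : Measurable F2)
    (hG : Measurable G) (hK : Measurable K) (a b : ℝ) (hab : a + b = 1)
    (h : ∀ x y, F1 x * F2 y ≤ G (a • x + b • y) * K (x - y)) :
    (∫⁻ x, F1 x) * (∫⁻ x, F2 x) ≤ (∫⁻ x, G x) * (∫⁻ x, K x) := by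
  calc (∫⁻ x, F1 x) * (∫⁻ x, F2 x) = ∫⁻ x, ∫⁻ y, F1 x * F2 y := by
        rw [← lintegral_mul_const _ hF1]
        refine lintegral_congr fun x => ?_
        rw [lintegral_const_mul _ hF2]
    _ ≤ ∫⁻ x, ∫⁻ y, G (a • x + b • y) * K (x - y) :=
        lintegral_mono fun x => lintegral_mono fun y => h x y
    _ = ∫⁻ x, ∫⁻ w, G (x - b • w) * K w := by
        refine lintegral_congr fun x => ?_
        rw [← lintegral_sub_left_eq_self (fun w => G (x - b • w) * K w) x]
        refine lintegral_congr fun y => ?_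
        congr 2
        have : a = 1 - b := by linarith
        rw [this]; module
    _ = ∫⁻ w, ∫⁻ x, G (x - b • w) * K w := by
        apply lintegral_lintegral_swap
        apply Measurable.aemeasurable
        apply Measurable.mul
        · exact hG.comp (by fun_prop)
        · exact hK.comp measurable_snd
    _ = ∫⁻ w, (∫⁻ x, G x) * K w := by
        refine lintegral_congr fun w => ?_
        have hm : Measurable fun x => G (x - b • w) := hG.comp (by fun_prop)
        rw [lintegral_mul_const _ hm, lintegral_sub_right_eq_self]
    _ = _ := lintegral_const_mul _ hK

lemma lint_two (f : ℝ × ℝ → ENNReal) (hf : Measurable f) :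
    ∫⁻ x : Fin 2 → ℝ, f (x 0, x 1) = ∫⁻ x, ∫⁻ y, f (x, y) := by
  have := (volume_preserving_finTwoArrow ℝ).lintegral_comp hf
  rw [Measure.volume_eq_prod, lintegral_prod _ hf.aemeasurable] at this
  exact this

open ProbabilityTheory in
lemma gd_total (a b d t : ℝ) (ha : 0 < a) (hD : 0 < a * d - b * b) (ht : 0 < t) :
    ∫⁻ x : Fin 2 → ℝ, ENNReal.ofReal (gaussDensity (t⁻¹ • !![a, b; b, d]) x) = 1 := by
  set D := a * d - b * b with hDdef
  have hv1 : 0 < a / t := by positivity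
  have hv2 : 0 < D / (t * a) := by positivity
  let v1 : NNReal := ⟨a / t, hv1.le⟩
  let v2 : NNReal := ⟨D / (t * a), hv2.le⟩
  have hv1n : v1 ≠ 0 := fun h => hv1.ne' (congrArg NNReal.toReal h)
  have hv2n : v2 ≠ 0 := fun h => hv2.ne' (congrArg NNReal.toReal h)
  have key : ∀ x : Fin 2 → ℝ, ENNReal.ofReal (gaussDensity (t⁻¹ • !![a, b; b, d]) x) =
      gaussianPDF 0 v1 (x 0) * gaussianPDF 0 v2 (x 1 - b / a * x 0) := by
    intro x
    rw [gd_formula a b d t ha hD ht, gaussianPDF, gaussianPDF,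
      ← ENNReal.ofReal_mul (gaussianPDFReal_nonneg _ _ _)]
    congr 1
    unfold gaussianPDFReal
    have e1 : (v1 : ℝ) = a / t := rfl
    have e2 : (v2 : ℝ) = D / (t * a) := rfl
    rw [e1, e2]
    have hs : (√(2 * π * (a / t)))⁻¹ * (√(2 * π * (D / (t * a))))⁻¹ = (2 * π)⁻¹ * (t * (√D)⁻¹) := by
      rw [← mul_inv, ← Real.sqrt_mul (by positivity)]
      have : 2 * π * (a / t) * (2 * π * (D / (t * a))) = (2 * π / t) ^ 2 * D := by
        field_simp
      rw [this, Real.sqrt_mul (by positivity), Real.sqrt_sq (by positivity)]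
      field_simp
    rw [mul_mul_mul_comm, hs, ← Real.exp_add]
    congr 2
    have hd : d = (D + b * b) / a := by rw [hDdef]; field_simp; ring
    rw [← hDdef, hd]
    field_simp
    ring
  simp_rw [key]
  rw [lint_two (fun p => gaussianPDF 0 v1 p.1 * gaussianPDF 0 v2 (p.2 - b / a * p.1))]
  · have : ∀ x : ℝ, ∫⁻ y, gaussianPDF 0 v1 x * gaussianPDF 0 v2 (y - b / a * x)
        = gaussianPDF 0 v1 x := by
      intro x
      have hm : Measurable fun y => gaussianPDF 0 v2 (y - b / a * x) :=
        (measurable_gaussianPDF _ _).comp (by fun_prop)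
      rw [lintegral_const_mul _ hm,
        lintegral_sub_right_eq_self (fun y => gaussianPDF 0 v2 y),
        lintegral_gaussianPDF_eq_one _ hv2n, mul_one]
    simp_rw [this]
    exact lintegral_gaussianPDF_eq_one _ hv1n
  · exact ((measurable_gaussianPDF _ _).comp measurable_fst).mul
      ((measurable_gaussianPDF _ _).comp (by fun_prop))

/-- The integrand as an extended nonnegative function. -/
def Fint (MA MB : ℕ) (a b d t : ℝ) (x : Fin 2 → ℝ) : ENNReal :=
  ({x : Fin 2 → ℝ | -1 < x 0 ∧ -1 < x 1}).indicator (fun x => ENNReal.ofReal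
    ((1 + x 0) ^ MA * (1 + x 1) ^ MB * gaussDensity (t⁻¹ • !![a, b; b, d]) x)) x

lemma measQ : MeasurableSet {x : Fin 2 → ℝ | -1 < x 0 ∧ -1 < x 1} :=
  (measurableSet_lt measurable_const (measurable_pi_apply 0)).inter
    (measurableSet_lt measurable_const (measurable_pi_apply 1))

lemma gd_meas (S : Matrix (Fin 2) (Fin 2) ℝ) : Measurable (gaussDensity S) := by
  have : Continuous (gaussDensity S) := by
    unfold gaussDensity
    simp only [Matrix.mulVec, dotProduct, Fin.sum_univ_two]
    fun_prop
  exact this.measurable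

lemma gd_nonneg (S : Matrix (Fin 2) (Fin 2) ℝ) (x) : 0 ≤ gaussDensity S x := by
  unfold gaussDensity; positivity

lemma Fint_meas (MA MB : ℕ) (a b d t : ℝ) : Measurable (Fint MA MB a b d t) := by
  have := gd_meas (t⁻¹ • !![a, b; b, d])
  exact Measurable.indicator (by fun_prop) measQ

lemma Zstar_eq (MA MB : ℕ) (hA hB hAB : ℝ) (t : ℝ) (ht : ((MA + MB : ℕ) : ℝ) = t) :
    Zstar MA MB hA hB hAB = (∫⁻ x, Fint MA MB (rexp hA) (rexp hAB) (rexp hB) t x).toReal := by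
  unfold Zstar Fint
  have := gd_meas (t⁻¹ • !![rexp hA, rexp hAB; rexp hAB, rexp hB])
  rw [ht, covW, lintegral_indicator measQ, integral_eq_lintegral_of_nonneg_ae]
  · filter_upwards [self_mem_ae_restrict measQ] with x hx
    have h0 : 0 < 1 + x 0 := by linarith [hx.1]
    have h1 : 0 < 1 + x 1 := by linarith [hx.2]
    have := gd_nonneg (t⁻¹ • !![rexp hA, rexp hAB; rexp hAB, rexp hB]) x
    simp only [Pi.zero_apply]
    positivity
  · apply Measurable.aestronglyMeasurable
    fun_prop

lemma poly_gauss_int (n : ℕ) (c : ℝ) (hc : 0 < c) :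
    Integrable (fun x : ℝ => (1 + x) ^ n * rexp (-c * x ^ 2)) := by
  have : (fun x : ℝ => (1 + x) ^ n * rexp (-c * x ^ 2)) = fun x =>
      ∑ k ∈ Finset.range (n + 1), (n.choose k : ℝ) * (x ^ k * rexp (-c * x ^ 2)) := by
    ext x
    rw [add_comm, add_pow, Finset.sum_mul]
    refine Finset.sum_congr rfl fun k _ => ?_
    simp; ring
  rw [this]
  refine integrable_finsetSum _ fun k _ => Integrable.const_mul ?_ _
  have := integrable_rpow_mul_exp_neg_mul_sq hc (s := k) (by
    have : (0:ℝ) ≤ k := k.cast_nonneg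
    linarith)
  simpa using this

lemma Fint_finite (MA MB : ℕ) (a b d t : ℝ) (ha : 0 < a) (hd : 0 < d) (hD : 0 < a * d - b * b)
    (ht : 0 < t) : ∫⁻ x, Fint MA MB a b d t x ≠ ⊤ := by
  set D := a * d - b * b with hDdef
  set C := (2 * π)⁻¹ * (t * (√D)⁻¹) with hC
  have hC0 : 0 ≤ C := by positivity
  let f : ℝ → ℝ := fun x => (1 + x) ^ MA * rexp (-(t / (4 * a)) * x ^ 2)
  let g : ℝ → ℝ := fun x => (1 + x) ^ MB * rexp (-(t / (4 * d)) * x ^ 2)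
  have hf : Integrable f := poly_gauss_int _ _ (by positivity)
  have hg : Integrable g := poly_gauss_int _ _ (by positivity)
  have hfm : Measurable f := by fun_prop
  have hgm : Measurable g := by fun_prop
  have hle : ∀ x, Fint MA MB a b d t x ≤ ENNReal.ofReal C * (‖f (x 0)‖ₑ * ‖g (x 1)‖ₑ) := by
    intro x
    unfold Fint
    refine Set.indicator_apply_le' (fun hx => ?_) (fun _ => zero_le)
    have h0 : 0 < 1 + x 0 := by linarith [hx.1]
    have h1 : 0 < 1 + x 1 := by linarith [hx.2]
    rw [Real.enorm_eq_ofReal (by positivity : 0 ≤ f (x 0)),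
      Real.enorm_eq_ofReal (by positivity : 0 ≤ g (x 1)), ← ENNReal.ofReal_mul (by positivity),
      ← ENNReal.ofReal_mul hC0]
    apply ENNReal.ofReal_le_ofReal
    rw [gd_formula a b d t ha hD ht, ← hDdef, ← hC]
    have hq1 : x 0 ^ 2 / a ≤ (d * x 0 ^ 2 - 2 * b * x 0 * x 1 + a * x 1 ^ 2) / D := by
      rw [div_le_div_iff₀ ha hD, hDdef]; nlinarith [sq_nonneg (a * x 1 - b * x 0)]
    have hq2 : x 1 ^ 2 / d ≤ (d * x 0 ^ 2 - 2 * b * x 0 * x 1 + a * x 1 ^ 2) / D := by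
      rw [div_le_div_iff₀ hd hD, hDdef]; nlinarith [sq_nonneg (d * x 0 - b * x 1)]
    have hexp : rexp (-(t / 2) * ((d * x 0 ^ 2 - 2 * b * x 0 * x 1 + a * x 1 ^ 2) / D)) ≤
        rexp (-(t / (4 * a)) * x 0 ^ 2) * rexp (-(t / (4 * d)) * x 1 ^ 2) := by
      rw [← Real.exp_add]
      apply Real.exp_le_exp.2
      have : -(t / (4 * a)) * x 0 ^ 2 + -(t / (4 * d)) * x 1 ^ 2 =
        -(t / 2) * ((x 0 ^ 2 / a + x 1 ^ 2 / d) / 2) := by field_simp; ring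
      rw [this]
      nlinarith
    calc _ ≤ (1 + x 0) ^ MA * (1 + x 1) ^ MB *
          (C * (rexp (-(t / (4 * a)) * x 0 ^ 2) * rexp (-(t / (4 * d)) * x 1 ^ 2))) := by gcongr
      _ = _ := by simp only [f, g]; ring
  refine ne_top_of_le_ne_top ?_ (lintegral_mono hle)
  rw [lint_two (fun p => ENNReal.ofReal C * (‖f p.1‖ₑ * ‖g p.2‖ₑ))
    (by fun_prop)]
  have : ∀ x : ℝ, ∫⁻ y, ENNReal.ofReal C * (‖f x‖ₑ * ‖g y‖ₑ) =
      ENNReal.ofReal C * (‖f x‖ₑ * ∫⁻ y, ‖g y‖ₑ) := by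
    intro x
    rw [lintegral_const_mul _ (by fun_prop), lintegral_const_mul _ (by fun_prop)]
  simp_rw [this]
  rw [lintegral_const_mul _ (by fun_prop), lintegral_mul_const _ (by fun_prop)]
  exact ENNReal.mul_ne_top ENNReal.ofReal_ne_top (ENNReal.mul_ne_top hf.2.ne hg.2.ne)

theorem stmt16 (hA hB hAB : ℝ) (hW : (covW hA hB hAB).PosDef)
    (α : ℝ) (hα : α ∈ Set.Ioo (0 : ℝ) 1)
    (N₁ N₂ : ℕ) (hN₁ : 0 < N₁) (hN₂ : 0 < N₂) (M₁ M₂ : ℕ)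
    (hM₁ : (M₁ : ℝ) = α * N₁) (hM₂ : (M₂ : ℝ) = α * N₂) :
    Zstar M₁ (N₁ - M₁) hA hB hAB * Zstar M₂ (N₂ - M₂) hA hB hAB ≤
      Zstar (M₁ + M₂) ((N₁ + N₂) - (M₁ + M₂)) hA hB hAB := by
  have n1 : (0 : ℝ) < N₁ := by exact_mod_cast hN₁
  have n2 : (0 : ℝ) < N₂ := by exact_mod_cast hN₂
  have l1 : M₁ ≤ N₁ := by
    have : (M₁ : ℝ) ≤ N₁ := by rw [hM₁]; nlinarith [hα.2]
    exact_mod_cast this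
  have l2 : M₂ ≤ N₂ := by
    have : (M₂ : ℝ) ≤ N₂ := by rw [hM₂]; nlinarith [hα.2]
    exact_mod_cast this
  obtain ⟨K₁, rfl⟩ := Nat.exists_eq_add_of_le l1
  obtain ⟨K₂, rfl⟩ := Nat.exists_eq_add_of_le l2
  have s1 : M₁ + K₁ - M₁ = K₁ := by omega
  have s2 : M₂ + K₂ - M₂ = K₂ := by omega
  have s3 : (M₁ + K₁) + (M₂ + K₂) - (M₁ + M₂) = K₁ + K₂ := by omega
  rw [s1, s2, s3]
  have hD := hW.det_pos
  have ha := Real.exp_pos hA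
  have hd := Real.exp_pos hB
  rw [covW, Matrix.det_fin_two_of] at hD
  have hK₁ : (K₁ : ℝ) = (1 - α) * ((M₁ + K₁ : ℕ) : ℝ) := by
    have : ((M₁ + K₁ : ℕ) : ℝ) = M₁ + K₁ := by push_cast; ring
    linarith
  have hK₂ : (K₂ : ℝ) = (1 - α) * ((M₂ + K₂ : ℕ) : ℝ) := by
    have : ((M₂ + K₂ : ℕ) : ℝ) = M₂ + K₂ := by push_cast; ring
    linarith
  rw [Zstar_eq M₁ K₁ hA hB hAB _ rfl, Zstar_eq M₂ K₂ hA hB hAB _ rfl,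
    Zstar_eq (M₁ + M₂) (K₁ + K₂) hA hB hAB (((M₁ + K₁ : ℕ) : ℝ) + ((M₂ + K₂ : ℕ) : ℝ))
      (by push_cast; ring)]
  generalize ((M₁ + K₁ : ℕ) : ℝ) = t1 at *
  generalize ((M₂ + K₂ : ℕ) : ℝ) = t2 at *
  generalize rexp hA = a at *
  generalize rexp hB = d at *
  generalize rexp hAB = b at *
  have hT : 0 < t1 + t2 := by positivity
  have hs : 0 < t1 * t2 / (t1 + t2) := by positivity
  rw [← ENNReal.toReal_mul]
  refine ENNReal.toReal_mono (Fint_finite _ _ _ _ _ _ ha hd hD hT) ?_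
  have hmain := conv_le (Fint M₁ K₁ a b d t1) (Fint M₂ K₂ a b d t2)
    (Fint (M₁ + M₂) (K₁ + K₂) a b d (t1 + t2))
    (fun x => ENNReal.ofReal (gaussDensity ((t1 * t2 / (t1 + t2))⁻¹ • !![a, b; b, d]) x))
    (Fint_meas _ _ _ _ _ _) (Fint_meas _ _ _ _ _ _) (Fint_meas _ _ _ _ _ _)
    (gd_meas _).ennreal_ofReal (t1 / (t1 + t2)) (t2 / (t1 + t2)) (by field_simp) ?_
  · rwa [gd_total a b d _ ha hD hs, mul_one] at hmain
  intro x y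
  by_cases hx : x ∈ {x : Fin 2 → ℝ | -1 < x 0 ∧ -1 < x 1}
  swap
  · simp [Fint, Set.indicator_of_notMem hx]
  by_cases hy : y ∈ {x : Fin 2 → ℝ | -1 < x 0 ∧ -1 < x 1}
  swap
  · simp [Fint, Set.indicator_of_notMem hy]
  have x0 : 0 < 1 + x 0 := by linarith [hx.1]
  have x1 : 0 < 1 + x 1 := by linarith [hx.2]
  have y0 : 0 < 1 + y 0 := by linarith [hy.1]
  have y1 : 0 < 1 + y 1 := by linarith [hy.2]
  set z := (t1 / (t1 + t2)) • x + (t2 / (t1 + t2)) • y with hz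
  have hzi : ∀ i, 1 + z i = t1 / (t1 + t2) * (1 + x i) + t2 / (t1 + t2) * (1 + y i) := by
    intro i
    simp only [hz, Pi.add_apply, Pi.smul_apply, smul_eq_mul]
    field_simp
    ring
  have z0 : 0 < 1 + z 0 := by rw [hzi]; positivity
  have z1 : 0 < 1 + z 1 := by rw [hzi]; positivity
  have hzQ : z ∈ {x : Fin 2 → ℝ | -1 < x 0 ∧ -1 < x 1} :=
    ⟨by linarith, by linarith⟩
  have A0 := amgm_pow α _ _ t1 t2 M₁ M₂ n1 n2 rfl rfl hM₁ hM₂ _ _ x0 y0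
  have A1 := amgm_pow (1 - α) _ _ t1 t2 K₁ K₂ n1 n2 rfl rfl hK₁ hK₂ _ _ x1 y1
  rw [← hzi] at A0 A1
  have hdens : gaussDensity (t1⁻¹ • !![a, b; b, d]) x * gaussDensity (t2⁻¹ • !![a, b; b, d]) y =
      gaussDensity ((t1 + t2)⁻¹ • !![a, b; b, d]) z *
        gaussDensity ((t1 * t2 / (t1 + t2))⁻¹ • !![a, b; b, d]) (x - y) := by
    rw [gd_formula a b d _ ha hD n1, gd_formula a b d _ ha hD n2, gd_formula a b d _ ha hD hT,
      gd_formula a b d _ ha hD hs]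
    rw [mul_mul_mul_comm, mul_mul_mul_comm (_ * _) (rexp _) (_ * _) (rexp _), ← Real.exp_add,
      ← Real.exp_add]
    congr 1
    · field_simp
    · congr 1
      simp only [hz, Pi.add_apply, Pi.smul_apply, smul_eq_mul, Pi.sub_apply]
      generalize a * d - b * b = D at *
      field_simp
      ring
  have g1 := gd_nonneg (t1⁻¹ • !![a, b; b, d]) x
  have g2 := gd_nonneg (t2⁻¹ • !![a, b; b, d]) y
  have g3 := gd_nonneg ((t1 + t2)⁻¹ • !![a, b; b, d]) z
  have g4 := gd_nonneg ((t1 * t2 / (t1 + t2))⁻¹ • !![a, b; b, d]) (x - y)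
  simp only [Fint, Set.indicator_of_mem hx, Set.indicator_of_mem hy, Set.indicator_of_mem hzQ]
  rw [← ENNReal.ofReal_mul (by positivity), ← ENNReal.ofReal_mul (by positivity)]
  apply ENNReal.ofReal_le_ofReal
  calc _ = ((1 + x 0) ^ M₁ * (1 + y 0) ^ M₂) * ((1 + x 1) ^ K₁ * (1 + y 1) ^ K₂) *
        (gaussDensity (t1⁻¹ • !![a, b; b, d]) x * gaussDensity (t2⁻¹ • !![a, b; b, d]) y) := by ring
    _ ≤ (1 + z 0) ^ (M₁ + M₂) * (1 + z 1) ^ (K₁ + K₂) *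
        (gaussDensity (t1⁻¹ • !![a, b; b, d]) x * gaussDensity (t2⁻¹ • !![a, b; b, d]) y) := by
      gcongr
    _ = _ := by rw [hdens]; ring
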